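/- Let I be an ideal of R[x] whose invariant sequence is (α^{e_0}, …, α^{e_i}, 1, …, 1) up to associates, where α ∈ F[x] is irreducible, e_0 ≥ e_1 ≥ ⋯ ≥ e_i > 0, and the entries with index i+1, …, n-1 equal 1. Then: (i) there is a unique ideal of R[x] containing I whose invariant sequence is (α^{e_0}, …, α^{e_{i-1}}, α^{e_i − 1}, 1, …, 1) up to associates; (ii) R[x]/I is Frobenius and local if and only if for each 0 ≤ j ≤ i−1 with e_j > e_{j+1}, there is no ideal of R[x] containing I whose invariant sequence is (α^{e_0}, …, α^{e_{j-1}}, α^{e_j − 1}, α^{e_{j+1}}, …, α^{e_i}, 1, …, 1) up to associates. -/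

import Mathlib

open Polynomial

/-- A commutative ring `S` is *Frobenius* if it is artinian and `S/rad(S)` is isomorphic,
as an `S`-module, to the socle of `S` (the sum of all minimal ideals of `S`). -/
def IsFrobeniusRing (S : Type*) [CommRing S] : Prop :=
  IsArtinianRing S ∧
    Nonempty ((S ⧸ Ideal.jacobson (⊥ : Ideal S)) ≃ₗ[S]
      (sSup {J : Ideal S | IsAtom J} : Ideal S))

/-- The reduction map `R[x] → (R/πR)[x]`. -/
noncomputable def redMod {R : Type*} [CommRing R] (π : R) :
    R[X] →+* (R ⧸ Ideal.span {π})[X] :=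
  Polynomial.mapRingHom (Ideal.Quotient.mk (Ideal.span {π}))

/-- `(f 0, …, f (n-1))` is a canonical sequence of the ideal `I` of `R[x]`. -/
def IsCanonicalSequence {R : Type*} [CommRing R] (π : R) (n : ℕ)
    (I : Ideal R[X]) (f : ℕ → R[X]) : Prop :=
  ∀ i < n, (C π ^ i * f i ∈ I) ∧
    ∀ g : R[X], C π ^ i * g ∈ I →
      redMod π g = 0 ∨ (redMod π (f i) ≠ 0 ∧ (redMod π (f i)).degree ≤ (redMod π g).degree)

/-- The ideal `J` of `R[x]` has invariant sequence `(β 0, …, β (n-1))` up to associates. -/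
def HasInvariantSequence {R : Type*} [CommRing R] (π : R) (n : ℕ)
    (J : Ideal R[X]) (β : ℕ → (R ⧸ Ideal.span {π})[X]) : Prop :=
  ∃ g : ℕ → R[X], IsCanonicalSequence π n J g ∧
    ∀ j < n, Associated (redMod π (g j)) (β j)

section LocalArtinian

variable {S : Type*} [CommRing S]

/-- A local artinian ring is Frobenius iff it has a least nonzero ideal. -/
theorem isFrobeniusRing_iff_exists_least [IsArtinianRing S] [IsLocalRing S] :
    IsFrobeniusRing S ↔ ∃ A : Ideal S, A ≠ ⊥ ∧ ∀ B : Ideal S, B ≠ ⊥ → A ≤ B := by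
  have hjac : Ideal.jacobson (⊥ : Ideal S) = IsLocalRing.maximalIdeal S :=
    IsLocalRing.jacobson_eq_maximalIdeal ⊥ bot_ne_top
  constructor
  · rintro ⟨-, ⟨φ⟩⟩
    rw [hjac] at φ
    have hsimple : IsSimpleModule S (S ⧸ IsLocalRing.maximalIdeal S) :=
      isSimpleModule_iff_isCoatom.2 (IsLocalRing.maximalIdeal.isMaximal S).out
    have hsoc := IsSimpleModule.congr φ.symm
    have hatom := isSimpleModule_iff_isAtom.1 hsoc
    refine ⟨_, hatom.1, fun B hB => ?_⟩
    obtain ⟨C, hC, hCB⟩ := (eq_bot_or_exists_atom_le B).resolve_left hB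
    have hCs : C ≤ sSup {J : Ideal S | IsAtom J} := le_sSup hC
    rwa [← (hatom.le_iff.1 hCs).resolve_left hC.1]
  · rintro ⟨A, hA, hle⟩
    have hatom : IsAtom A := ⟨hA, fun B hB => by
      by_contra h
      exact hB.not_ge (hle B h)⟩
    have hsoc : sSup {J : Ideal S | IsAtom J} = A := by
      refine le_antisymm (sSup_le fun B hB => ?_) (le_sSup hatom)
      exact ((IsAtom.le_iff hB).1 (hle B hB.1)).resolve_left hA |>.ge
    refine ⟨inferInstance, ?_⟩
    rw [hjac, hsoc]
    have := isSimpleModule_iff_isAtom.2 hatom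
    obtain ⟨m, hm, ⟨φ⟩⟩ := isSimpleModule_iff_quot_maximal.1 this
    rw [IsLocalRing.eq_maximalIdeal hm] at φ
    exact ⟨φ.symm⟩

/-- Nilpotent elements annihilate minimal ideals. -/
theorem IsNilpotent.mul_eq_zero_of_isAtom {B : Ideal S} (hB : IsAtom B) {x b : S}
    (hx : IsNilpotent x) (hb : b ∈ B) : x * b = 0 := by
  have hle : Ideal.span {x * b} ≤ B :=
    (Ideal.span_singleton_le_iff_mem _).2 (B.mul_mem_left x hb)
  rcases hB.le_iff.1 hle with h | h
  · simpa using h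
  · rw [← h, Ideal.mem_span_singleton'] at hb
    obtain ⟨c, hc⟩ := hb
    have hu : IsUnit (1 - c * x) := ((Commute.all c x).isNilpotent_mul_left hx).isUnit_one_sub
    have h0 : (1 - c * x) * b = 0 := by linear_combination -hc
    rw [hu.mul_right_eq_zero.1 h0, mul_zero]

end LocalArtinian

section Layer

variable {R : Type*} [CommRing R] {π : R}

theorem redMod_surjective : Function.Surjective (redMod π) :=
  Polynomial.map_surjective _ Ideal.Quotient.mk_surjective

theorem redMod_eq_zero_iff {g : R[X]} : redMod π g = 0 ↔ C π ∣ g := by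
  rw [Polynomial.C_dvd_iff_dvd_coeff, Polynomial.ext_iff]
  simp [redMod, Ideal.Quotient.eq_zero_iff_mem, Ideal.mem_span_singleton]

theorem exists_of_redMod_eq {g h : R[X]} (hgh : redMod π g = redMod π h) :
    ∃ k, g = h + C π * k := by
  obtain ⟨k, hk⟩ := redMod_eq_zero_iff.1 (show redMod π (g - h) = 0 by rw [map_sub, hgh, sub_self])
  exact ⟨k, by rw [← hk]; ring⟩

@[simp]
theorem redMod_C_self : redMod π (C π) = 0 := redMod_eq_zero_iff.2 dvd_rfl

/-- The ideal of reductions of polynomials `g` with `π ^ j * g ∈ I`. -/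
noncomputable def layer (π : R) (I : Ideal R[X]) (j : ℕ) : Ideal (R ⧸ Ideal.span {π})[X] :=
  Ideal.map (redMod π) (Submodule.comap (LinearMap.mulLeft R[X] (C π ^ j)) I)

variable {I J : Ideal R[X]} {j n : ℕ}

theorem mem_layer {y : (R ⧸ Ideal.span {π})[X]} :
    y ∈ layer π I j ↔ ∃ g, C π ^ j * g ∈ I ∧ redMod π g = y := by
  rw [layer, Ideal.mem_map_iff_of_surjective _ redMod_surjective]
  rfl

theorem layer_mono (h : I ≤ J) (j : ℕ) : layer π I j ≤ layer π J j := fun y hy => by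
  obtain ⟨g, hg, rfl⟩ := mem_layer.1 hy
  exact mem_layer.2 ⟨g, h hg, rfl⟩

theorem le_of_layer_le (hnil : π ^ n = 0) (hIJ : I ≤ J)
    (h : ∀ j < n, layer π J j ≤ layer π I j) : J ≤ I := by
  have key : ∀ k ≤ n, ∀ g, C π ^ (n - k) * g ∈ J → C π ^ (n - k) * g ∈ I := by
    intro k
    induction k with
    | zero => intro _ g _; simp [← C_pow, hnil]
    | succ k ih =>
      intro hk g hg
      obtain ⟨g', hg', hred⟩ := mem_layer.1 (h (n - (k + 1)) (by omega) (mem_layer.2 ⟨g, hg, rfl⟩))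
      obtain ⟨q, rfl⟩ := exists_of_redMod_eq hred.symm
      have hpow : C π ^ (n - k) * q = C π ^ (n - (k + 1)) * (g' + C π * q)
          - C π ^ (n - (k + 1)) * g' := by
        rw [show n - k = n - (k + 1) + 1 by omega]; ring
      have := ih (by omega) q (by rw [hpow]; exact J.sub_mem hg (hIJ hg'))
      rw [hpow] at this
      simpa using I.add_mem this hg'
  intro g hg
  simpa using key n le_rfl g (by simpa using hg)

theorem layer_sup_span_of_lt {l : ℕ} (hl : l < j) (g : R[X]) :
    layer π (I ⊔ Ideal.span {C π ^ j * g}) l = layer π I l := by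
  refine le_antisymm (fun y hy => ?_) (layer_mono le_sup_left l)
  obtain ⟨h, hh, rfl⟩ := mem_layer.1 hy
  obtain ⟨x, hx, z, hz, hxz⟩ := Submodule.mem_sup.1 hh
  obtain ⟨c, rfl⟩ := Ideal.mem_span_singleton'.1 hz
  refine mem_layer.2 ⟨h - C π * (c * C π ^ (j - l - 1) * g), ?_, by simp⟩
  convert hx using 1
  rw [mul_sub, ← hxz, show j = l + ((j - l - 1) + 1) by omega,
    show l + ((j - l - 1) + 1) - l - 1 = j - l - 1 by omega]
  ring

theorem layer_sup_span_self (g : R[X]) :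
    layer π (I ⊔ Ideal.span {C π ^ j * g}) j = layer π I j ⊔ Ideal.span {redMod π g} := by
  refine le_antisymm (fun y hy => ?_) (sup_le (layer_mono le_sup_left j) ?_)
  · obtain ⟨h, hh, rfl⟩ := mem_layer.1 hy
    obtain ⟨x, hx, z, hz, hxz⟩ := Submodule.mem_sup.1 hh
    obtain ⟨c, rfl⟩ := Ideal.mem_span_singleton'.1 hz
    refine Submodule.mem_sup.2 ⟨redMod π (h - c * g), mem_layer.2 ⟨_, ?_, rfl⟩,
      redMod π (c * g), Ideal.mem_span_singleton'.2 ⟨redMod π c, by simp⟩, by simp⟩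
    convert hx using 1
    linear_combination -hxz
  · rw [Ideal.span_singleton_le_iff_mem]
    exact mem_layer.2 ⟨g, Ideal.mem_sup_right (Ideal.mem_span_singleton_self _), rfl⟩

theorem C_pow_mem_of_layer_eq_top (hnil : IsNilpotent π) (h : layer π I j = ⊤) :
    C π ^ j ∈ I := by
  obtain ⟨g, hg, hg1⟩ := mem_layer.1 ((Ideal.eq_top_iff_one _).1 h)
  obtain ⟨k, rfl⟩ := exists_of_redMod_eq (hg1.trans (map_one (redMod π)).symm)
  have hu : IsUnit (1 + C π * k) :=
    ((Commute.all (C π) k).isNilpotent_mul_right (hnil.map C)).isUnit_one_add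
  exact (Ideal.mul_unit_mem_iff_mem I hu).1 hg

theorem IsCanonicalSequence.layer_eq [(Ideal.span {π}).IsMaximal] {f : ℕ → R[X]}
    (h : IsCanonicalSequence π n I f) (hj : j < n) :
    layer π I j = Ideal.span {redMod π (f j)} := by
  let _ := Ideal.Quotient.field (Ideal.span {π})
  obtain ⟨hmem, hmin⟩ := h j hj
  have hfj : redMod π (f j) ∈ layer π I j := mem_layer.2 ⟨_, hmem, rfl⟩
  refine le_antisymm (fun y hy => ?_) ((Ideal.span_singleton_le_iff_mem _).2 hfj)
  rw [Ideal.mem_span_singleton]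
  have hmod : y % redMod π (f j) ∈ layer π I j := by
    rw [EuclideanDomain.mod_eq_sub_mul_div]
    exact Ideal.sub_mem _ hy (Ideal.mul_mem_right _ _ hfj)
  obtain ⟨g, hg, hgy⟩ := mem_layer.1 hmod
  rcases hmin g hg with h0 | ⟨hne, hdeg⟩
  · rw [hgy] at h0
    exact EuclideanDomain.mod_eq_zero.1 h0
  · rw [hgy] at hdeg
    exact absurd (EuclideanDomain.mod_lt y hne) (not_lt.2 hdeg)

theorem hasInvariantSequence_iff [(Ideal.span {π}).IsMaximal]
    {β : ℕ → (R ⧸ Ideal.span {π})[X]} :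
    HasInvariantSequence π n I β ↔ ∀ j < n, layer π I j = Ideal.span {β j} := by
  let _ := Ideal.Quotient.field (Ideal.span {π})
  constructor
  · rintro ⟨g, hg, hass⟩ j hj
    rw [hg.layer_eq hj, Ideal.span_singleton_eq_span_singleton]
    exact hass j hj
  · intro h
    have hex : ∀ j, ∃ g, j < n → C π ^ j * g ∈ I ∧ redMod π g = β j := fun j => by
      by_cases hj : j < n
      · have hmem : β j ∈ layer π I j := h j hj ▸ Ideal.mem_span_singleton_self _
        obtain ⟨g, hg⟩ := mem_layer.1 hmem
        exact ⟨g, fun _ => hg⟩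
      · exact ⟨0, fun h => absurd h hj⟩
    choose g hg using hex
    refine ⟨g, fun j hj => ⟨(hg j hj).1, fun k hk => ?_⟩, fun j hj => by rw [(hg j hj).2]⟩
    have hkl : redMod π k ∈ layer π I j := mem_layer.2 ⟨k, hk, rfl⟩
    rw [h j hj, Ideal.mem_span_singleton] at hkl
    rw [(hg j hj).2, or_iff_not_imp_left]
    exact fun hk0 => ⟨ne_zero_of_dvd_ne_zero hk0 hkl, Polynomial.degree_le_of_dvd hkl hk0⟩

end Layer

section Quotient

variable {R : Type*} [CommRing R] {π : R}
  {I : Ideal R[X]} {α : (R ⧸ Ideal.span {π})[X]} {a : R[X]} {m : ℕ}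

theorem comap_redMod_span_eq (ha : redMod π a = α) :
    Ideal.comap (redMod π) (Ideal.span {α}) = Ideal.span {C π, a} := by
  ext g
  rw [Ideal.mem_comap, Ideal.mem_span_singleton', Ideal.mem_span_pair]
  constructor
  · rintro ⟨c, hc⟩
    obtain ⟨c, rfl⟩ := redMod_surjective c
    obtain ⟨k, hk⟩ := exists_of_redMod_eq (g := g) (h := c * a) (by rw [← hc, map_mul, ha])
    exact ⟨k, c, by rw [hk]; ring⟩
  · rintro ⟨k, c, rfl⟩
    exact ⟨redMod π c, by simp [ha]⟩

theorem isMaximal_comap_redMod [(Ideal.span {π}).IsMaximal] (hα : Irreducible α) :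
    (Ideal.comap (redMod π) (Ideal.span {α})).IsMaximal := by
  let _ := Ideal.Quotient.field (Ideal.span {π})
  have := PrincipalIdealRing.isMaximal_of_irreducible hα
  exact Ideal.comap_isMaximal_of_surjective _ redMod_surjective

theorem isNilpotent_mk_of_layer_zero (hnil : IsNilpotent π) (ha : redMod π a = α)
    (h0 : layer π I 0 = Ideal.span {α ^ m}) : IsNilpotent (Ideal.Quotient.mk I a) := by
  have hmem : α ^ m ∈ layer π I 0 := h0 ▸ Ideal.mem_span_singleton_self _
  obtain ⟨g, hg, hgα⟩ := mem_layer.1 hmem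
  rw [pow_zero, one_mul] at hg
  obtain ⟨k, hk⟩ := exists_of_redMod_eq (g := a ^ m) (h := g) (by rw [hgα, map_pow, ha])
  refine IsNilpotent.of_pow (m := m) ?_
  rw [← map_pow, hk, map_add, Ideal.Quotient.eq_zero_iff_mem.2 hg, zero_add]
  exact ((Commute.all (C π) k).isNilpotent_mul_right (hnil.map C)).map _

theorem isArtinianRing_and_isLocalRing_quotient [(Ideal.span {π}).IsMaximal]
    (hnil : IsNilpotent π) (hα : Irreducible α)
    (hm : m ≠ 0) (h0 : layer π I 0 = Ideal.span {α ^ m}) :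
    IsArtinianRing (R[X] ⧸ I) ∧ IsLocalRing (R[X] ⧸ I) := by
  obtain ⟨a, ha⟩ := redMod_surjective α
  have hM := isMaximal_comap_redMod hα
  have hIM : I ≤ Ideal.comap (redMod π) (Ideal.span {α}) := fun g hg => by
    have : redMod π g ∈ layer π I 0 := mem_layer.2 ⟨g, by simpa using hg, rfl⟩
    rw [h0, Ideal.mem_span_singleton] at this
    exact Ideal.mem_span_singleton.2 ((dvd_pow_self α hm).trans this)
  have : Nontrivial (R[X] ⧸ I) := Ideal.Quotient.nontrivial_iff.2 fun h =>
    hM.ne_top (top_le_iff.1 (h ▸ hIM))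
  have hN := hM
  rw [comap_redMod_span_eq ha] at hN hIM
  set N := (Ideal.span {C π, a}).map (Ideal.Quotient.mk I) with hNdef
  have hNmax : N.IsMaximal := by
    refine (Ideal.map_eq_top_or_isMaximal_of_surjective _ Ideal.Quotient.mk_surjective hN
      ).resolve_left fun h => hN.ne_top ?_
    have := congrArg (Ideal.comap (Ideal.Quotient.mk I)) h
    rwa [Ideal.comap_map_of_surjective _ Ideal.Quotient.mk_surjective, ← RingHom.ker_eq_comap_bot,
      Ideal.mk_ker, sup_eq_left.2 hIM, Ideal.comap_top] at this
  have hprime : ∀ P : Ideal (R[X] ⧸ I), P.IsPrime → P = N := fun P hP => by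
    refine (hNmax.eq_of_le hP.ne_top ?_).symm
    rw [hNdef, Ideal.map_span, Ideal.span_le]
    rintro _ ⟨x, rfl | rfl, rfl⟩
    · exact nilpotent_iff_mem_prime.1 ((hnil.map C).map _) P hP
    · exact nilpotent_iff_mem_prime.1 (isNilpotent_mk_of_layer_zero hnil ha h0) P hP
  have hnoeth : IsNoetherianRing (R[X] ⧸ I) := IsNoetherianRing.of_prime fun P hP => by
    rw [hprime P hP]
    exact (Ideal.FG.map (Submodule.fg_span (by simp)) _)
  have hdim : Ring.KrullDimLE 0 (R[X] ⧸ I) :=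
    Ring.krullDimLE_zero_iff.2 fun P hP => hprime P hP ▸ hNmax
  exact ⟨isArtinianRing_iff_isNoetherianRing_krullDimLE_zero.2 ⟨hnoeth, hdim⟩,
    IsLocalRing.of_unique_max_ideal ⟨N, hNmax, fun P hP => hprime P hP.isPrime⟩⟩

/-- Any element outside `I` generates, together with `I`, the preimage of a minimal ideal
containing its class. -/
theorem sup_span_eq_comap_of_isAtom {B : Ideal (R[X] ⧸ I)} (hB : IsAtom B) {y : R[X]}
    (hy : Ideal.Quotient.mk I y ∈ B) (hyI : y ∉ I) :
    I ⊔ Ideal.span {y} = B.comap (Ideal.Quotient.mk I) := by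
  have hle : Ideal.span {Ideal.Quotient.mk I y} ≤ B := (Ideal.span_singleton_le_iff_mem _).2 hy
  have hne : Ideal.span {Ideal.Quotient.mk I y} ≠ ⊥ := fun h =>
    hyI (Ideal.Quotient.eq_zero_iff_mem.1 (Ideal.span_singleton_eq_bot.1 h))
  have heq := (hB.le_iff.1 hle).resolve_left hne
  rw [← heq, ← Set.image_singleton, ← Ideal.map_span,
    Ideal.comap_map_of_surjective _ Ideal.Quotient.mk_surjective, ← RingHom.ker_eq_comap_bot,
    Ideal.mk_ker, sup_comm]

theorem le_and_ne_comap_mk {B : Ideal (R[X] ⧸ I)} (hB : B ≠ ⊥) :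
    I ≤ B.comap (Ideal.Quotient.mk I) ∧ ¬ B.comap (Ideal.Quotient.mk I) ≤ I := by
  refine ⟨fun x hx => ?_, fun h => hB (eq_bot_iff.2 fun y hy => ?_)⟩
  · rw [Ideal.mem_comap, Ideal.Quotient.eq_zero_iff_mem.2 hx]
    exact B.zero_mem
  · obtain ⟨y, rfl⟩ := Ideal.Quotient.mk_surjective y
    exact Ideal.Quotient.eq_zero_iff_mem.2 (h hy)

theorem map_mk_ne_bot {J : Ideal R[X]} (h : ¬ J ≤ I) : J.map (Ideal.Quotient.mk I) ≠ ⊥ :=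
  fun h' => h (by rwa [Ideal.map_eq_bot_iff_le_ker, Ideal.mk_ker] at h')

theorem comap_le_of_le_map_mk {J : Ideal R[X]} {B : Ideal (R[X] ⧸ I)} (hIJ : I ≤ J)
    (h : B ≤ J.map (Ideal.Quotient.mk I)) : B.comap (Ideal.Quotient.mk I) ≤ J := by
  refine (Ideal.comap_mono h).trans ?_
  rw [Ideal.comap_map_of_surjective _ Ideal.Quotient.mk_surjective, ← RingHom.ker_eq_comap_bot,
    Ideal.mk_ker, sup_eq_left.2 hIJ]

end Quotient

section PowerLayers

variable {R : Type*} [CommRing R] {π : R}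
  {I : Ideal R[X]} {α : (R ⧸ Ideal.span {π})[X]} {a : R[X]} {i m n : ℕ} {E : ℕ → ℕ}

theorem span_pow_le_span_pow [(Ideal.span {π}).IsMaximal] (hα : Irreducible α) {k l : ℕ} :
    Ideal.span {α ^ k} ≤ Ideal.span {α ^ l} ↔ l ≤ k := by
  let _ := Ideal.Quotient.field (Ideal.span {π})
  rw [Ideal.span_singleton_le_span_singleton, pow_dvd_pow_iff hα.ne_zero hα.not_isUnit]

theorem layer_sup_span_pow_eq (ha : redMod π a = α) (hI : layer π I i = Ideal.span {α ^ m}) :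
    layer π (I ⊔ Ideal.span {C π ^ i * a ^ (m - 1)}) i = Ideal.span {α ^ (m - 1)} := by
  rw [layer_sup_span_self, map_pow, ha, hI, sup_eq_right, Ideal.span_singleton_le_span_singleton]
  exact pow_dvd_pow α (Nat.sub_le m 1)

/-- An ideal above `I` which lowers the last nontrivial layer by one factor `α` and leaves the
other layers unchanged is generated over `I` by one explicit element. -/
theorem eq_sup_span_of_layer_eq {J : Ideal R[X]} (hnil : π ^ n = 0) (ha : redMod π a = α)
    (htop : C π ^ (i + 1) ∈ I) (hIJ : I ≤ J)
    (hne : ∀ j < n, j ≠ i → layer π J j = layer π I j)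
    (hJ : layer π J i = Ideal.span {α ^ (m - 1)}) :
    J = I ⊔ Ideal.span {C π ^ i * a ^ (m - 1)} := by
  have hmem : α ^ (m - 1) ∈ layer π J i := hJ ▸ Ideal.mem_span_singleton_self _
  obtain ⟨g, hg, hgα⟩ := mem_layer.1 hmem
  obtain ⟨k, hk⟩ := exists_of_redMod_eq (g := a ^ (m - 1)) (h := g) (by rw [hgα, map_pow, ha])
  have hle : I ⊔ Ideal.span {C π ^ i * a ^ (m - 1)} ≤ J := by
    refine sup_le hIJ ((Ideal.span_singleton_le_iff_mem _).2 ?_)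
    rw [hk, mul_add, ← mul_assoc, ← pow_succ]
    exact J.add_mem hg (J.mul_mem_right _ (hIJ htop))
  refine le_antisymm (le_of_layer_le hnil hle fun j hj => ?_) hle
  by_cases hji : j = i
  · rw [hji, hJ, layer_sup_span_self, map_pow, ha]
    exact le_sup_right
  · rw [hne j hj hji]
    exact layer_mono le_sup_left j

/-- The preimage of a minimal ideal of `R[x]/I` has the same layers as `I`, except for one, which
loses one factor `α` and is a place where the exponents drop. -/
theorem exists_layer_comap_of_isAtom [(Ideal.span {π}).IsMaximal] (hα : Irreducible α)
    (hnil : π ^ n = 0)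
    (hI : ∀ j < n, layer π I j = Ideal.span {α ^ E j})
    {B : Ideal (R[X] ⧸ I)} (hB : IsAtom B) :
    ∃ j < n, 0 < E j ∧ (j + 1 < n → E (j + 1) < E j) ∧
      layer π (B.comap (Ideal.Quotient.mk I)) j = Ideal.span {α ^ (E j - 1)} ∧
      ∀ l < n, l ≠ j → layer π (B.comap (Ideal.Quotient.mk I)) l = layer π I l := by
  classical
  let _ := Ideal.Quotient.field (Ideal.span {π})
  obtain ⟨a, ha⟩ := redMod_surjective α
  obtain ⟨hIK, hKI⟩ := le_and_ne_comap_mk hB.1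
  set K := B.comap (Ideal.Quotient.mk I) with hK
  have hex : ∃ j < n, ¬ layer π K j ≤ layer π I j := by
    by_contra! h
    exact hKI (le_of_layer_le hnil hIK h)
  have hnil' : IsNilpotent π := ⟨n, hnil⟩
  have hann : ∀ x : R[X], IsNilpotent (Ideal.Quotient.mk I x) → ∀ y ∈ K, x * y ∈ I :=
    fun x hx y hy => by
      rw [← Ideal.Quotient.eq_zero_iff_mem, map_mul]
      exact hx.mul_eq_zero_of_isAtom hB hy
  obtain ⟨j, ⟨hjn, hj⟩, hjmax⟩ : ∃ j, (j < n ∧ ¬ layer π K j ≤ layer π I j) ∧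
      ∀ l, l < n → j < l → layer π K l ≤ layer π I l := by
    obtain ⟨j₀, hj₀⟩ := hex
    refine ⟨Nat.findGreatest (fun j => j < n ∧ ¬ layer π K j ≤ layer π I j) n,
      Nat.findGreatest_spec (P := fun j => j < n ∧ ¬ layer π K j ≤ layer π I j) hj₀.1.le hj₀,
      fun l hl hjl => ?_⟩
    by_contra h
    exact Nat.findGreatest_is_greatest hjl hl.le ⟨hl, h⟩
  have hn : 0 < n := by omega
  have haN := isNilpotent_mk_of_layer_zero hnil' ha (hI 0 hn)
  obtain ⟨y, hyK, hyI⟩ := SetLike.not_le_iff_exists.1 hj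
  have hαy : α * y ∈ layer π I j := by
    obtain ⟨g, hg, rfl⟩ := mem_layer.1 hyK
    refine mem_layer.2 ⟨a * g, ?_, by rw [map_mul, ha]⟩
    rw [mul_left_comm]
    exact hann a haN _ hg
  rw [hI j hjn, Ideal.mem_span_singleton] at hyI hαy
  have hpos : 0 < E j := by
    rw [Nat.pos_iff_ne_zero]
    rintro h
    simp [h] at hyI
  have hmem : α ^ (E j - 1) ∈ layer π K j := by
    have hE : α ^ E j = α * α ^ (E j - 1) := by rw [← pow_succ', Nat.sub_add_cancel hpos]
    have hpK : α ^ E j ∈ layer π K j :=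
      layer_mono hIK j (hI j hjn ▸ Ideal.mem_span_singleton_self _)
    obtain ⟨z, rfl⟩ : α ^ (E j - 1) ∣ y := by
      rw [hE] at hαy
      exact (mul_dvd_mul_iff_left hα.ne_zero).1 hαy
    have hz : ¬ α ∣ z := fun h => hyI (by
      rw [hE, mul_comm α]
      exact mul_dvd_mul_left _ h)
    obtain ⟨u, v, huv⟩ := (hα.coprime_iff_not_dvd.2 hz)
    have : α ^ (E j - 1) = u * α ^ E j + v * (α ^ (E j - 1) * z) := by
      rw [hE]
      linear_combination (-α ^ (E j - 1)) * huv
    rw [this]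
    exact Ideal.add_mem _ (Ideal.mul_mem_left _ _ hpK) (Ideal.mul_mem_left _ _ hyK)
  obtain ⟨g, hg, hgα⟩ := mem_layer.1 hmem
  have hgI : C π ^ j * g ∉ I := fun h => by
    have h' : α ^ (E j - 1) ∈ layer π I j := mem_layer.2 ⟨g, h, hgα⟩
    rw [hI j hjn, ← Ideal.span_singleton_le_iff_mem, span_pow_le_span_pow hα] at h'
    omega
  have hKeq : I ⊔ Ideal.span {C π ^ j * g} = K := sup_span_eq_comap_of_isAtom hB hg hgI
  refine ⟨j, hjn, hpos, fun hj1 => ?_, ?_, fun l hl hlj => ?_⟩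
  · have h' : α ^ (E j - 1) ∈ layer π I (j + 1) := mem_layer.2 ⟨g, by
      rw [pow_succ', mul_assoc]
      exact hann _ ((hnil'.map C).map _) _ hg, hgα⟩
    rw [hI _ hj1, ← Ideal.span_singleton_le_iff_mem, span_pow_le_span_pow hα] at h'
    omega
  · rw [← hKeq, layer_sup_span_self, hgα, hI j hjn, sup_eq_right, span_pow_le_span_pow hα]
    omega
  · rcases lt_or_gt_of_ne hlj with h | h
    · rw [← hKeq, layer_sup_span_of_lt h]
    · exact le_antisymm (hjmax l hl h) (layer_mono hIK l)

end PowerLayers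

/-- Proposition 6.5: for an ideal `I` with invariant sequence
`(α^{e_0}, …, α^{e_i}, 1, …, 1)`, `α` irreducible, `e_i > 0`:
(i) there is a unique ideal containing `I` with invariant sequence
`(α^{e_0}, …, α^{e_{i-1}}, α^{e_i - 1}, 1, …, 1)`; and
(ii) `R[x]/I` is Frobenius and local iff for each `j < i` with `e_j > e_{j+1}` there is no
ideal containing `I` with invariant sequence
`(α^{e_0}, …, α^{e_{j-1}}, α^{e_j - 1}, α^{e_{j+1}}, …, α^{e_i}, 1, …, 1)`. -/
theorem frobenius_local_iff_no_ideal_above {R : Type*} [CommRing R] [IsLocalRing R]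
    (π : R) (n : ℕ) (hn : 1 ≤ n)
    (hmax : IsLocalRing.maximalIdeal R = Ideal.span {π})
    (hnil : π ^ n = 0) (hne : π ^ (n - 1) ≠ 0)
    (I : Ideal R[X]) (f : ℕ → R[X]) (hcan : IsCanonicalSequence π n I f)
    (α : (R ⧸ Ideal.span {π})[X]) (hα : Irreducible α)
    (e : ℕ → ℕ) (i : ℕ) (hi : i < n)
    (hmono : ∀ j : ℕ, j + 1 ≤ i → e (j + 1) ≤ e j) (hei : 0 < e i)
    (hassoc : ∀ j ≤ i, Associated (redMod π (f j)) (α ^ e j))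
    (hone : ∀ j : ℕ, i < j → j < n → IsUnit (redMod π (f j))) :
    (∃! J : Ideal R[X], I ≤ J ∧
      HasInvariantSequence π n J
        (fun l => if l < i then α ^ e l else if l = i then α ^ (e i - 1) else 1)) ∧
    ((IsFrobeniusRing (R[X] ⧸ I) ∧ IsLocalRing (R[X] ⧸ I)) ↔
      ∀ j < i, e (j + 1) < e j →
        ¬ ∃ J : Ideal R[X], I ≤ J ∧
          HasInvariantSequence π n J
            (fun l => if l = j then α ^ (e j - 1) else if l ≤ i then α ^ e l else 1)) := by
  have hmaxI : (Ideal.span {π}).IsMaximal := hmax ▸ IsLocalRing.maximalIdeal.isMaximal R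
  have hnil' : IsNilpotent π := ⟨n, hnil⟩
  obtain ⟨a, ha⟩ := redMod_surjective α
  set E : ℕ → ℕ := fun l => if l ≤ i then e l else 0 with hE
  have hI : ∀ j < n, layer π I j = Ideal.span {α ^ E j} := fun j hj => by
    rw [hcan.layer_eq hj]
    by_cases hji : j ≤ i
    · simpa [hE, hji, Ideal.span_singleton_eq_span_singleton] using hassoc j hji
    · simpa [hE, hji, Ideal.span_singleton_eq_top] using hone j (not_le.1 hji) hj
  have hEi : E i = e i := by simp [hE]
  have htop : C π ^ (i + 1) ∈ I := by
    by_cases hin : i + 1 < n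
    · refine C_pow_mem_of_layer_eq_top hnil' ?_
      rw [hI _ hin]
      simp [hE]
    · rw [show i + 1 = n by omega, ← C_pow, hnil, C_0]
      exact I.zero_mem
  have hi' : layer π I i = Ideal.span {α ^ e i} := by rw [hI i hi, hEi]
  have hseq : ∀ {J : Ideal R[X]} {j : ℕ}, j ≤ i →
      ((∀ l < n, layer π J l =
        Ideal.span {if l = j then α ^ (e j - 1) else if l ≤ i then α ^ e l else 1}) ↔
      layer π J j = Ideal.span {α ^ (e j - 1)} ∧ ∀ l < n, l ≠ j → layer π J l = layer π I l) := by
    intro J j hji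
    constructor
    · refine fun h => ⟨by simpa using h j (by omega), fun l hl hlj => ?_⟩
      rw [h l hl, hI l hl]
      by_cases hli : l ≤ i <;> simp [hE, hli, hlj]
    · rintro ⟨h₁, h₂⟩ l hl
      by_cases hlj : l = j
      · simpa [hlj] using h₁
      · rw [h₂ l hl hlj, hI l hl]
        by_cases hli : l ≤ i <;> simp [hE, hli, hlj]
  have hβ : (fun l => if l < i then α ^ e l else if l = i then α ^ (e i - 1) else 1) =
      fun l => if l = i then α ^ (e i - 1) else if l ≤ i then α ^ e l else 1 := by
    funext l
    split_ifs <;> first | rfl | omega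
  rw [hβ]
  simp only [hasInvariantSequence_iff]
  set J₀ := I ⊔ Ideal.span {C π ^ i * a ^ (e i - 1)} with hJ₀
  have hIJ₀ : I ≤ J₀ := le_sup_left
  have hJ₀i : layer π J₀ i = Ideal.span {α ^ (e i - 1)} := layer_sup_span_pow_eq ha hi'
  have hJ₀ne : ∀ l < n, l ≠ i → layer π J₀ l = layer π I l := fun l hl hli => by
    rcases lt_or_gt_of_ne hli with h | h
    · exact layer_sup_span_of_lt h _
    · have hIl : layer π I l = ⊤ := by
        rw [hI l hl]
        simp [hE, not_le.2 h]
      rw [hIl]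
      exact top_le_iff.1 (hIl ▸ layer_mono hIJ₀ l)
  have huniq : ∀ J : Ideal R[X], I ≤ J → layer π J i = Ideal.span {α ^ (e i - 1)} →
      (∀ l < n, l ≠ i → layer π J l = layer π I l) → J = J₀ := fun J hIJ h₁ h₂ =>
    eq_sup_span_of_layer_eq hnil ha htop hIJ h₂ h₁
  refine ⟨⟨J₀, ⟨hIJ₀, (hseq le_rfl).2 ⟨hJ₀i, hJ₀ne⟩⟩, fun J ⟨hIJ, hJ⟩ =>
    huniq J hIJ ((hseq le_rfl).1 hJ).1 ((hseq le_rfl).1 hJ).2⟩, ?_⟩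
  have hanti : ∀ k ≤ i, e i ≤ e (i - k) := by
    intro k
    induction k with
    | zero => intro _; rfl
    | succ k ih =>
      intro hk
      have := hmono (i - (k + 1)) (by omega)
      rw [show i - (k + 1) + 1 = i - k by omega] at this
      exact (ih (by omega)).trans this
  have he0 : E 0 ≠ 0 := by
    have := hanti i le_rfl
    simp only [hE, Nat.zero_le, if_true]
    rw [Nat.sub_self] at this
    omega
  obtain ⟨hArt, hLoc⟩ := isArtinianRing_and_isLocalRing_quotient hnil' hα he0 (hI 0 hn)
  rw [isFrobeniusRing_iff_exists_least, and_iff_left hLoc]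
  constructor
  · rintro ⟨A, hA, hAle⟩ j hj hej ⟨J, hIJ, hJ⟩
    obtain ⟨hJj, hJne⟩ := (hseq hj.le).1 hJ
    obtain ⟨hIA, hAI⟩ := le_and_ne_comap_mk hA
    have hJI : ¬ J ≤ I := fun h => by
      have := layer_mono (π := π) h j
      rw [hJj, hI j (by omega), span_pow_le_span_pow hα] at this
      simp only [hE, hj.le, if_true] at this
      omega
    have hJ₀I : ¬ J₀ ≤ I := fun h => by
      have := layer_mono (π := π) h i
      rw [hJ₀i, hi', span_pow_le_span_pow hα] at this
      omega
    have hAJ := comap_le_of_le_map_mk hIJ (hAle _ (map_mk_ne_bot hJI))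
    have hAJ₀ := comap_le_of_le_map_mk hIJ₀ (hAle _ (map_mk_ne_bot hJ₀I))
    refine hAI (le_of_layer_le hnil hIA fun l hl => ?_)
    by_cases hli : l = i
    · rw [← hJne l hl (by omega)]
      exact layer_mono hAJ l
    · rw [← hJ₀ne l hl hli]
      exact layer_mono hAJ₀ l
  · intro hno
    have hcomap : ∀ B : Ideal (R[X] ⧸ I), IsAtom B → B.comap (Ideal.Quotient.mk I) = J₀ := by
      intro B hB
      obtain ⟨j, hjn, hpos, hdrop, hBj, hBne⟩ := exists_layer_comap_of_isAtom hα hnil hI hB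
      have hji : j ≤ i := by
        by_contra h
        simp [hE, h] at hpos
      have hIB := (le_and_ne_comap_mk hB.1).1
      have hEj : E j = e j := by simp [hE, hji]
      rw [hEj] at hBj hdrop
      rcases hji.lt_or_eq with h | rfl
      · have hdrop := hdrop (by omega)
        simp only [hE, Nat.succ_le_of_lt h, if_true] at hdrop
        exact absurd ⟨_, hIB, (hseq hji).2 ⟨hBj, hBne⟩⟩ (hno j h hdrop)
      · exact huniq _ hIB hBj hBne
    obtain ⟨A, hA, -⟩ := (eq_bot_or_exists_atom_le (⊤ : Ideal (R[X] ⧸ I))).resolve_left top_ne_bot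
    refine ⟨A, hA.1, fun B hB => ?_⟩
    obtain ⟨B', hB', hle⟩ := (eq_bot_or_exists_atom_le B).resolve_left hB
    have := (hcomap A hA).trans (hcomap B' hB').symm
    rwa [Ideal.comap_injective_of_surjective _ Ideal.Quotient.mk_surjective this]
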